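/- Let V be a finite-dimensional real vector space with subspace Vᵘ spanned by e₁,…,e_u, and let e'₁,…,e'_u be another basis of the same subspace Vᵘ. Then the subspaces of derivative-like u-vectors coincide: D_e = D_{e'}, where D_e := { Σᵢ e₁ ∧ ⋯ ∧ pᵢ ∧ ⋯ ∧ e_u : pᵢ ∈ V } and similarly for D_{e'}. -/

import Mathlib

namespace AlternatingMap

variable {R M N ι : Type*} [CommRing R] [AddCommGroup M] [Module R M] [AddCommGroup N] [Module R N]
  [Fintype ι] [DecidableEq ι]

/-- Replacing one entry of a reindexed family gives a value in the range of the linear derivative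
of an alternating map at that family. -/
lemma map_update_comp_mem_range_linearDeriv (f : M [⋀^ι]→ₗ[R] N) (e : ι → M) (s : ι → ι)
    (i : ι) (v : M) :
    f (Function.update (e ∘ s) i v) ∈ LinearMap.range (f.toMultilinearMap.linearDeriv e) := by
  by_cases hs : Set.InjOn s {i}ᶜ
  · obtain ⟨k, hk⟩ : ∃ k, ∀ j, j ≠ i → s j ≠ k := by
      by_contra! h
      have hlt : (Finset.univ.erase i).card < (Finset.univ : Finset ι).card :=
        Finset.card_erase_lt_of_mem (Finset.mem_univ i)
      refine hlt.not_ge (Finset.card_le_card_of_surjOn s fun k _ => ?_)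
      obtain ⟨j, hj, hjk⟩ := h k
      exact ⟨j, by simpa using hj, hjk⟩
    have hinj : Function.Injective (Function.update s i k) := by
      intro a b hab
      by_cases ha : a = i <;> by_cases hb : b = i
      · rw [ha, hb]
      · subst ha
        simp only [Function.update_self, Function.update_of_ne hb] at hab
        exact absurd hab.symm (hk b hb)
      · subst hb
        simp only [Function.update_self, Function.update_of_ne ha] at hab
        exact absurd hab (hk a ha)
      · simp only [Function.update_of_ne ha, Function.update_of_ne hb] at hab
        exact hs ha hb hab
    let σ : Equiv.Perm ι := Equiv.ofBijective _ (Finite.injective_iff_bijective.mp hinj)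
    have hσ : Function.update (e ∘ s) i v = Function.update e k v ∘ σ := by
      funext j
      by_cases hj : j = i
      · subst hj
        simp [σ]
      · simp [σ, hj, hk j hj]
    have hmem : f (Function.update e k v) ∈
        LinearMap.range (f.toMultilinearMap.linearDeriv e) := by
      refine ⟨Pi.single k v, ?_⟩
      rw [MultilinearMap.linearDeriv_apply, Finset.sum_eq_single k]
      · simp
      · intro b _ hb
        exact f.map_coord_zero b (by simp [hb])
      · simp
    rw [hσ, f.map_perm, Units.smul_def]
    exact zsmul_mem hmem _
  · obtain ⟨a, ha, b, hb, hab, hne⟩ : ∃ a, a ≠ i ∧ ∃ b, b ≠ i ∧ s a = s b ∧ a ≠ b := by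
      simpa [Set.InjOn] using hs
    rw [f.map_eq_zero_of_eq _ (by simp [ha, hb, hab]) hne]
    exact zero_mem _

/-- The range of the linear derivative of an alternating map at a family is monotone in the span
of that family. -/
lemma range_linearDeriv_mono (f : M [⋀^ι]→ₗ[R] N) {e e' : ι → M}
    (h : Submodule.span R (Set.range e) ≤ Submodule.span R (Set.range e')) :
    LinearMap.range (f.toMultilinearMap.linearDeriv e) ≤
      LinearMap.range (f.toMultilinearMap.linearDeriv e') := by
  rintro _ ⟨p, rfl⟩
  rw [MultilinearMap.linearDeriv_apply]
  refine sum_mem fun i _ => ?_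
  have he : ∀ j, ∃ c : ι → R, ∑ k, c k • e' k = e j := fun j =>
    (Submodule.mem_span_range_iff_exists_fun R).mp (h (Submodule.subset_span ⟨j, rfl⟩))
  choose A hA using he
  have hexp : Function.update e i (p i) = fun j => ∑ k,
      Function.update A i (Pi.single i 1) j k • Function.update (fun _ => e' k) i (p i) j := by
    funext j
    by_cases hj : j = i
    · subst hj
      simp [Pi.single_apply]
    · simp [hj, hA]
  rw [hexp, MultilinearMap.map_sum]
  refine sum_mem fun s _ => ?_
  rw [MultilinearMap.map_smul_univ]
  exact Submodule.smul_mem _ _ (f.map_update_comp_mem_range_linearDeriv e' s i (p i))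

end AlternatingMap

theorem derivative_like_space_independent_of_basis
    {V : Type*} [AddCommGroup V] [Module ℝ V] [FiniteDimensional ℝ V]
    (u : ℕ) (e e' : Fin u → V)
    (he : LinearIndependent ℝ e) (he' : LinearIndependent ℝ e')
    (hspan : Submodule.span ℝ (Set.range e) = Submodule.span ℝ (Set.range e')) :
    {x : ExteriorAlgebra ℝ V | ∃ p : Fin u → V,
        x = ∑ i, ExteriorAlgebra.ιMulti ℝ u (Function.update e i (p i))}
      = {x : ExteriorAlgebra ℝ V | ∃ p : Fin u → V,
        x = ∑ i, ExteriorAlgebra.ιMulti ℝ u (Function.update e' i (p i))} := by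
  have hrange (a : Fin u → V) : {x : ExteriorAlgebra ℝ V | ∃ p : Fin u → V,
      x = ∑ i, ExteriorAlgebra.ιMulti ℝ u (Function.update a i (p i))} =
      LinearMap.range ((ExteriorAlgebra.ιMulti ℝ u).toMultilinearMap.linearDeriv a) := by
    ext x
    simp [MultilinearMap.linearDeriv_apply, eq_comm]
  rw [hrange, hrange, le_antisymm (AlternatingMap.range_linearDeriv_mono _ hspan.le)
    (AlternatingMap.range_linearDeriv_mono _ hspan.ge)]
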